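/- For every n ≥ 2, the involution length of PU(n,1) is at most 8: for every (n+1)×(n+1) complex matrix A with Aᴴ Jₙ A = Jₙ there exist matrices I₁, …, I₈ satisfying I_kᴴ Jₙ I_k = Jₙ and I_k · I_k = 1 for k = 1,…,8, and a nonzero scalar λ ∈ ℂ, such that A = λ · (I₁ I₂ ⋯ I₈). (Factors I_k equal to ±1 are allowed, accounting for products of fewer than eight involutions.) -/

import Mathlib

open Matrix

/-- The Hermitian form of signature (n,1) on ℂ^{n+1}: the diagonal matrix whose first
n diagonal entries equal 1 and whose last entry equals −1. -/
noncomputable def Jform (n : ℕ) : Matrix (Fin (n + 1)) (Fin (n + 1)) ℂ :=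
  Matrix.diagonal (fun i => if (i : ℕ) < n then 1 else -1)

/-- Membership in U(n,1). -/
def InUn1 (n : ℕ) (A : Matrix (Fin (n + 1)) (Fin (n + 1)) ℂ) : Prop :=
  Aᴴ * Jform n * A = Jform n


/-- A unitary matrix squaring to the identity. -/
def IsUnitaryInvolution {m : Type*} [Fintype m] [DecidableEq m] (M : Matrix m m ℂ) : Prop :=
  Mᴴ * M = 1 ∧ M * M = 1

section Unitary

variable {m : Type*} [Fintype m] [DecidableEq m]

theorem IsUnitaryInvolution.conj {M V : Matrix m m ℂ} (hM : IsUnitaryInvolution M)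
    (hV : Vᴴ * V = 1) (hV' : V * Vᴴ = 1) : IsUnitaryInvolution (V * M * Vᴴ) := by
  constructor
  · calc (V * M * Vᴴ)ᴴ * (V * M * Vᴴ) = V * (Mᴴ * (Vᴴ * V) * M) * Vᴴ := by
          simp only [conjTranspose_mul, conjTranspose_conjTranspose, Matrix.mul_assoc]
      _ = 1 := by rw [hV, Matrix.mul_one, hM.1, Matrix.mul_one, hV']
  · calc V * M * Vᴴ * (V * M * Vᴴ) = V * (M * (Vᴴ * V) * M) * Vᴴ := by
          simp only [Matrix.mul_assoc]
      _ = 1 := by rw [hV, Matrix.mul_one, hM.2, Matrix.mul_one, hV']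

theorem exists_unit_det_smul_one_sub_ne_zero (U : Matrix m m ℂ) :
    ∃ θ : ℂ, star θ * θ = 1 ∧ (θ • (1 : Matrix m m ℂ) - U).det ≠ 0 := by
  have : Infinite (Set.Ioc (-Real.pi) Real.pi) :=
    Set.Ioc.infinite (by linarith [Real.pi_pos])
  have hinf : Infinite Circle := Infinite.of_injective _ Circle.argEquiv.symm.injective
  have : (Set.range (fun z : Circle => (z : ℂ))).Infinite :=
    Set.infinite_range_of_injective Circle.coe_injective
  obtain ⟨_, ⟨θ, rfl⟩, hθ⟩ := this.exists_notMem_finset U.charpoly.roots.toFinset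
  refine ⟨θ, ?_, ?_⟩
  · rw [Complex.star_def, ← Complex.normSq_eq_conj_mul_self]
    exact_mod_cast Circle.normSq_coe θ
  · intro h
    apply hθ
    rw [Multiset.mem_toFinset, Polynomial.mem_roots (charpoly_monic U).ne_zero,
      Polynomial.IsRoot, eval_charpoly, ← h, scalar_apply, ← smul_one_eq_diagonal]

/-- A unitary matrix is unitarily diagonalizable, by the spectral theorem applied to its
Cayley transform. -/
theorem exists_unitary_diagonalization (U : Matrix m m ℂ) (hU : Uᴴ * U = 1) :
    ∃ (V : Matrix m m ℂ) (d : m → ℂ), Vᴴ * V = 1 ∧ V * Vᴴ = 1 ∧ U = V * diagonal d * Vᴴ := by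
  obtain ⟨θ, hθ, hdet⟩ := exists_unit_det_smul_one_sub_ne_zero U
  have hθ' : θ * star θ = 1 := by rw [mul_comm, hθ]
  set D := θ • (1 : Matrix m m ℂ) - U with hD
  set T := θ • (1 : Matrix m m ℂ) + U with hT
  have hunit : IsUnit D.det := isUnit_iff_ne_zero.2 hdet
  have hunit' : IsUnit Dᴴ.det := by
    rw [det_conjTranspose]; exact hunit.star
  have key : Dᴴ * T = -(Tᴴ * D) := by
    simp only [hD, hT, conjTranspose_sub, conjTranspose_add, conjTranspose_smul,
      conjTranspose_one, Matrix.sub_mul, Matrix.mul_add, Matrix.add_mul, Matrix.mul_sub,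
      smul_mul_assoc, mul_smul_comm, Matrix.one_mul, Matrix.mul_one, hU, smul_add, smul_sub,
      smul_smul, hθ', one_smul]
    abel
  set H := Complex.I • (T * D⁻¹) with hH
  have hHD : H * D = Complex.I • T := by
    rw [hH, smul_mul_assoc, Matrix.mul_assoc, nonsing_inv_mul _ hunit, Matrix.mul_one]
  have hherm : H.IsHermitian := by
    have h1 : Dᴴ * Hᴴ * D = Dᴴ * H * D := by
      rw [Matrix.mul_assoc Dᴴ H, hHD, ← conjTranspose_mul, hHD, conjTranspose_smul,
        mul_smul_comm, key]
      simp
    have h2 := congrArg (fun X => (Dᴴ)⁻¹ * X * D⁻¹) h1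
    simpa only [IsHermitian, Matrix.mul_assoc, mul_nonsing_inv _ hunit, Matrix.mul_one,
      nonsing_inv_mul_cancel_left _ _ hunit'] using h2
  set V : Matrix m m ℂ := (hherm.eigenvectorUnitary).1 with hV
  have hV1 : Vᴴ * V = 1 := Unitary.coe_star_mul_self hherm.eigenvectorUnitary
  have hV2 : V * Vᴴ = 1 := Unitary.coe_mul_star_self hherm.eigenvectorUnitary
  set l : m → ℂ := RCLike.ofReal ∘ hherm.eigenvalues with hl
  have hspec : H = V * diagonal l * Vᴴ := by
    have := hherm.spectral_theorem
    rwa [Unitary.conjStarAlgAut_apply] at this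
  set W := Vᴴ * U * V with hW
  have hUW : U = V * W * Vᴴ := by
    calc U = (V * Vᴴ) * U * (V * Vᴴ) := by rw [hV2, Matrix.one_mul, Matrix.mul_one]
      _ = _ := by simp only [hW, Matrix.mul_assoc]
  have hWD : diagonal l * (θ • 1 - W) = Complex.I • (θ • 1 + W) := by
    have e1 : Vᴴ * D * V = θ • 1 - W := by
      simp [hD, hW, Matrix.mul_sub, Matrix.sub_mul, hV1]
    have e2 : Vᴴ * T * V = θ • 1 + W := by
      simp [hT, hW, Matrix.mul_add, Matrix.add_mul, hV1]
    have e3 : Vᴴ * H * V = diagonal l := by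
      rw [hspec]
      calc Vᴴ * (V * diagonal l * Vᴴ) * V = (Vᴴ * V) * diagonal l * (Vᴴ * V) := by
            simp only [Matrix.mul_assoc]
        _ = _ := by rw [hV1, Matrix.one_mul, Matrix.mul_one]
    rw [← e1, ← e2, ← e3]
    calc Vᴴ * H * V * (Vᴴ * D * V) = Vᴴ * (H * (V * Vᴴ) * D) * V := by
          simp only [Matrix.mul_assoc]
      _ = _ := by rw [hV2, Matrix.mul_one, hHD]; simp
  refine ⟨V, W.diag, hV1, hV2, ?_⟩
  rw [hUW]
  congr 2
  ext i j
  by_cases hij : i = j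
  · subst hij; simp
  · rw [diagonal_apply_ne _ hij]
    have h := congrFun (congrFun hWD i) j
    simp only [diagonal_mul, Matrix.sub_apply, Matrix.smul_apply, one_apply_ne hij,
      Matrix.add_apply, smul_eq_mul, mul_zero, zero_sub, zero_add] at h
    have h' : (l i + Complex.I) * W i j = 0 := by linear_combination -h
    rcases mul_eq_zero.1 h' with h0 | h0
    · have := congrArg Complex.im h0
      simp [hl] at this
    · exact h0

theorem diagonal_eq_mul_involutions (p : m → ℂ) (σ : m → m) (hσ : ∀ i, σ (σ i) = i)
    (hp : ∀ i, star (p i) * p i = 1) (hpσ : ∀ i, p i * p (σ i) = 1) :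
    ∃ M N : Matrix m m ℂ, IsUnitaryInvolution M ∧ IsUnitaryInvolution N ∧
      diagonal p = M * N := by
  set S : Matrix m m ℂ := of fun i j => if j = σ i then 1 else 0 with hS
  have hSS : S * S = 1 := by
    ext i j
    rw [mul_apply, Finset.sum_eq_single (σ i) (fun k _ hk => by simp [hS, hk]) (by simp)]
    simp [hS, hσ, one_apply, eq_comm]
  have hSH : Sᴴ = S := by
    ext i j
    simp only [hS, conjTranspose_apply, of_apply]
    have : i = σ j ↔ j = σ i := ⟨fun h => by rw [h, hσ], fun h => by rw [h, hσ]⟩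
    simp [this]
  have hSd : S * diagonal p = diagonal (p ∘ σ) * S := by
    ext i j
    simp only [hS, mul_diagonal, diagonal_mul, of_apply, Function.comp]
    split_ifs with h <;> simp [h]
  refine ⟨diagonal p * S, S, ⟨?_, ?_⟩, ⟨by rw [hSH, hSS], hSS⟩, ?_⟩
  · calc (diagonal p * S)ᴴ * (diagonal p * S) = S * ((diagonal p)ᴴ * diagonal p) * S := by
          rw [conjTranspose_mul, hSH]; simp only [Matrix.mul_assoc]
      _ = 1 := by
          rw [diagonal_conjTranspose, diagonal_mul_diagonal]
          simp only [Pi.star_apply, hp, diagonal_one, Matrix.mul_one, hSS]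
  · calc diagonal p * S * (diagonal p * S) = diagonal p * (S * diagonal p) * S := by
          simp only [Matrix.mul_assoc]
      _ = diagonal p * diagonal (p ∘ σ) * (S * S) := by rw [hSd]; simp only [Matrix.mul_assoc]
      _ = 1 := by
          rw [diagonal_mul_diagonal, hSS]
          simp [hpσ]
  · rw [Matrix.mul_assoc, hSS, Matrix.mul_one]

end Unitary

/-- The involution of `Fin m` exchanging `i` and `i + 1` for all `i` of the parity of `r`. -/
def parityFlip (m r : ℕ) (i : Fin m) : Fin m :=
  if (i : ℕ) % 2 = r then (if h : (i : ℕ) + 1 < m then ⟨i + 1, h⟩ else i)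
  else ⟨i - 1, by omega⟩

theorem parityFlip_parityFlip {m r : ℕ} (hr : r < 2) (i : Fin m) :
    parityFlip m r (parityFlip m r i) = i := by
  ext
  unfold parityFlip
  grind

/-- The diagonal with entries `S (i + 1)` and `(S i)⁻¹` according to the parity of `i`. -/
noncomputable def alternating (m r : ℕ) (S : ℕ → ℂ) (i : Fin m) : ℂ :=
  if (i : ℕ) % 2 = r then S (i + 1) else (S i)⁻¹

theorem alternating_mul_parityFlip {m r : ℕ} (hr : r < 2) {S : ℕ → ℂ} (h0 : S 0 = 1)
    (hS : ∀ k, S k ≠ 0) (hm : S m ^ 2 = 1) (i : Fin m) :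
    alternating m r S i * alternating m r S (parityFlip m r i) = 1 := by
  have hi := i.2
  have e1 : ((i : ℕ) + 1) % 2 = r ↔ ¬ (i : ℕ) % 2 = r := by omega
  unfold alternating parityFlip
  by_cases h : (i : ℕ) % 2 = r
  · by_cases h' : (i : ℕ) + 1 < m
    · simp [h, h', e1, hS]
    · have : (i : ℕ) + 1 = m := by omega
      simp [h, this, ← sq, hm]
  · rcases Nat.eq_zero_or_pos (i : ℕ) with h1 | h1
    · have : ¬ 0 = r := by simpa [h1] using h
      simp [h1, h0, this]
    · have h2 : ((i : ℕ) - 1) % 2 = r := by omega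
      have h3 : (i : ℕ) - 1 + 1 = i := by omega
      simp [h, h2, h3, hS]

theorem diagonal_eq_four_involutions {m : ℕ} (d : Fin m → ℂ) (hd : ∀ i, star (d i) * d i = 1)
    (hdet : (∏ i, d i) ^ 2 = 1) :
    ∃ M₁ M₂ M₃ M₄ : Matrix (Fin m) (Fin m) ℂ, IsUnitaryInvolution M₁ ∧
      IsUnitaryInvolution M₂ ∧ IsUnitaryInvolution M₃ ∧ IsUnitaryInvolution M₄ ∧
      diagonal d = M₁ * M₂ * (M₃ * M₄) := by
  set δ : ℕ → ℂ := fun k => if h : k < m then d ⟨k, h⟩ else 1 with hδ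
  have hδ1 : ∀ k, star (δ k) * δ k = 1 := by
    intro k
    simp only [hδ]
    split_ifs
    · exact hd _
    · simp
  set S : ℕ → ℂ := fun k => ∏ j ∈ Finset.range k, δ j with hSdef
  have hS1 : ∀ k, star (S k) * S k = 1 := by
    intro k
    simp only [hSdef, star_prod, ← Finset.prod_mul_distrib, hδ1, Finset.prod_const_one]
  have hS : ∀ k, S k ≠ 0 := fun k hk => by simpa [hk] using hS1 k
  have h0 : S 0 = 1 := by simp [hSdef]
  have hm : S m ^ 2 = 1 := by
    have : S m = ∏ i, d i := by
      simp only [hSdef, Finset.prod_range, hδ, Fin.is_lt, dite_true]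
    rw [this, hdet]
  have hunit : ∀ r i, star (alternating m r S i) * alternating m r S i = 1 := by
    intro r i
    unfold alternating
    split_ifs
    · exact hS1 _
    · rw [star_inv₀, ← mul_inv, hS1, inv_one]
  obtain ⟨M₁, M₂, h₁, h₂, h₁₂⟩ := diagonal_eq_mul_involutions (alternating m 0 S)
    (parityFlip m 0) (parityFlip_parityFlip (by norm_num)) (hunit 0)
    (alternating_mul_parityFlip (by norm_num) h0 hS hm)
  obtain ⟨M₃, M₄, h₃, h₄, h₃₄⟩ := diagonal_eq_mul_involutions (alternating m 1 S)
    (parityFlip m 1) (parityFlip_parityFlip (by norm_num)) (hunit 1)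
    (alternating_mul_parityFlip (by norm_num) h0 hS hm)
  refine ⟨M₁, M₂, M₃, M₄, h₁, h₂, h₃, h₄, ?_⟩
  rw [← h₁₂, ← h₃₄, diagonal_mul_diagonal]
  congr 1
  funext i
  have hsucc : S (i + 1) = S i * d i := by
    simp [hSdef, Finset.prod_range_succ, hδ]
  unfold alternating
  have := hS i
  rcases Nat.mod_two_eq_zero_or_one (i : ℕ) with h | h <;> simp [h, hsucc] <;> field_simp

theorem unitary_eq_four_involutions {m : ℕ} (U : Matrix (Fin m) (Fin m) ℂ) (hU : Uᴴ * U = 1)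
    (hdet : U.det ^ 2 = 1) :
    ∃ M₁ M₂ M₃ M₄ : Matrix (Fin m) (Fin m) ℂ, IsUnitaryInvolution M₁ ∧
      IsUnitaryInvolution M₂ ∧ IsUnitaryInvolution M₃ ∧ IsUnitaryInvolution M₄ ∧
      U = M₁ * M₂ * M₃ * M₄ := by
  obtain ⟨V, d, hV, hV', rfl⟩ := exists_unitary_diagonalization U hU
  have hd : (diagonal d)ᴴ * diagonal d = 1 := by
    calc (diagonal d)ᴴ * diagonal d
        = Vᴴ * ((V * diagonal d * Vᴴ)ᴴ * (V * diagonal d * Vᴴ)) * V := by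
          simp only [conjTranspose_mul, conjTranspose_conjTranspose, Matrix.mul_assoc, hV,
            Matrix.mul_one]
          simp only [← Matrix.mul_assoc, hV, Matrix.one_mul]
      _ = 1 := by rw [hU, Matrix.mul_one, hV]
  have hd' : ∀ i, star (d i) * d i = 1 := by
    intro i
    have := congrFun (congrFun hd i) i
    simpa [diagonal_conjTranspose, diagonal_mul_diagonal] using this
  have hdet' : (∏ i, d i) ^ 2 = 1 := by
    rwa [Matrix.det_mul_right_comm, hV', Matrix.one_mul, det_diagonal] at hdet
  obtain ⟨M₁, M₂, M₃, M₄, h₁, h₂, h₃, h₄, h⟩ := diagonal_eq_four_involutions d hd' hdet'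
  refine ⟨_, _, _, _, h₁.conj hV hV', h₂.conj hV hV', h₃.conj hV hV', h₄.conj hV hV', ?_⟩
  have cancel : ∀ X Y : Matrix (Fin m) (Fin m) ℂ,
      V * X * Vᴴ * (V * Y * Vᴴ) = V * (X * Y) * Vᴴ := by
    intro X Y
    calc V * X * Vᴴ * (V * Y * Vᴴ) = V * (X * (Vᴴ * V) * Y) * Vᴴ := by
          simp only [Matrix.mul_assoc]
      _ = _ := by rw [hV, Matrix.mul_one]
  rw [cancel, cancel, cancel, h, ← Matrix.mul_assoc (M₁ * M₂)]

section Hyperbolic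

variable {n : ℕ}

theorem Jform_mul_Jform : Jform n * Jform n = 1 := by
  rw [Jform, diagonal_mul_diagonal, ← diagonal_one]
  congr 1
  funext i
  split_ifs <;> simp

theorem Jform_conjTranspose : (Jform n)ᴴ = Jform n := by
  rw [Jform, diagonal_conjTranspose]
  congr 1
  funext i
  simp only [Pi.star_apply]
  split_ifs <;> simp

theorem InUn1.mul {A B : Matrix (Fin (n + 1)) (Fin (n + 1)) ℂ} (hA : InUn1 n A)
    (hB : InUn1 n B) : InUn1 n (A * B) := by
  unfold InUn1 at *
  calc (A * B)ᴴ * Jform n * (A * B) = Bᴴ * (Aᴴ * Jform n * A) * B := by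
        simp only [conjTranspose_mul, Matrix.mul_assoc]
    _ = Jform n := by rw [hA, hB]

theorem InUn1.smul {A : Matrix (Fin (n + 1)) (Fin (n + 1)) ℂ} (hA : InUn1 n A) {c : ℂ}
    (hc : star c * c = 1) : InUn1 n (c • A) := by
  unfold InUn1 at *
  rw [conjTranspose_smul, smul_mul_assoc, smul_mul_assoc, mul_smul_comm, smul_smul, hc, one_smul,
    hA]

theorem InUn1.star_det_mul_det {A : Matrix (Fin (n + 1)) (Fin (n + 1)) ℂ} (hA : InUn1 n A) :
    star A.det * A.det = 1 := by
  have hJ : (Jform n).det ≠ 0 := by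
    have := congrArg det (Jform_mul_Jform (n := n))
    rw [det_mul, det_one] at this
    exact left_ne_zero_of_mul_eq_one this
  have := congrArg det hA
  rw [det_mul, det_mul, det_conjTranspose] at this
  exact mul_right_cancel₀ hJ (by linear_combination this)

/-- The Hermitian form of signature `(n, 1)`, conjugate-linear in the first variable. -/
noncomputable def herm (v w : Fin (n + 1) → ℂ) : ℂ := star v ⬝ᵥ (Jform n *ᵥ w)

theorem herm_eq (v w : Fin (n + 1) → ℂ) :
    herm v w = ∑ i : Fin n, star (v i.castSucc) * w i.castSucc
      - star (v (Fin.last n)) * w (Fin.last n) := by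
  simp [herm, dotProduct, Jform, mulVec_diagonal, Fin.sum_univ_castSucc, sub_eq_add_neg]

theorem herm_sub_left (u v w : Fin (n + 1) → ℂ) : herm (u - v) w = herm u w - herm v w := by
  simp [herm, sub_dotProduct]

theorem herm_sub_right (u v w : Fin (n + 1) → ℂ) : herm u (v - w) = herm u v - herm u w := by
  simp [herm, mulVec_sub, dotProduct_sub]

theorem herm_smul_left (c : ℂ) (v w : Fin (n + 1) → ℂ) :
    herm (c • v) w = star c * herm v w := by
  simp [herm, smul_dotProduct]

theorem herm_smul_right (c : ℂ) (v w : Fin (n + 1) → ℂ) :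
    herm v (c • w) = c * herm v w := by
  simp [herm, mulVec_smul, dotProduct_smul]

theorem herm_neg_left (v w : Fin (n + 1) → ℂ) : herm (-v) w = -herm v w := by
  simp [herm]

theorem herm_neg_right (v w : Fin (n + 1) → ℂ) : herm v (-w) = -herm v w := by
  simp [herm, mulVec_neg]

theorem herm_symm (v w : Fin (n + 1) → ℂ) : herm w v = star (herm v w) := by
  simp [herm_eq, mul_comm]

theorem InUn1.herm_mulVec {A : Matrix (Fin (n + 1)) (Fin (n + 1)) ℂ} (hA : InUn1 n A)
    (v w : Fin (n + 1) → ℂ) : herm (A *ᵥ v) (A *ᵥ w) = herm v w := by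
  unfold herm
  rw [star_mulVec, ← dotProduct_mulVec, mulVec_mulVec, mulVec_mulVec, hA]

/-- Two vectors of norm `-1` with nonnegative inner product are exchanged by the reflection
in their difference. -/
theorem exists_involution_mulVec_eq {v w : Fin (n + 1) → ℂ} {t : ℝ} (ht : 0 ≤ t)
    (hv : herm v v = -1) (hw : herm w w = -1) (hvw : herm v w = t) :
    ∃ S, InUn1 n S ∧ S * S = 1 ∧ S *ᵥ v = w := by
  have hwv : herm w v = t := by rw [herm_symm, hvw]; simp
  set u := v - w with hu
  set N := vecMulVec u (star u ᵥ* Jform n) with hN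
  have hNx : ∀ x, N *ᵥ x = herm u x • u := by
    intro x
    rw [hN, vecMulVec_mulVec, ← dotProduct_mulVec]
    simp [herm]
  have huu : herm u u = -(2 + 2 * t) := by
    simp only [hu, herm_sub_left, herm_sub_right, hv, hw, hvw, hwv]; ring
  have huv : herm u v = -(1 + t) := by
    simp only [hu, herm_sub_left, hv, hwv]; ring
  have ht1 : (1 + t : ℂ) ≠ 0 := by
    exact_mod_cast (by positivity : (0 : ℝ) < 1 + t).ne'
  have hNN : N * N = (-(2 + 2 * t) : ℂ) • N := by
    conv_lhs => rw [hN, vecMulVec_mul_vecMulVec]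
    rw [← huu, hN, herm, dotProduct_mulVec, vecMulVec_smul]
  have hNJ : Nᴴ * Jform n = Jform n * N := by
    rw [hN, conjTranspose_vecMulVec, star_vecMul, star_star, Jform_conjTranspose, vecMulVec_mul,
      mul_vecMulVec]
  set b : ℂ := (1 + t : ℂ)⁻¹ with hb
  have hbstar : star b = b := by simp [hb]
  have hSS : (1 + b • N) * (1 + b • N) = 1 := by
    simp only [Matrix.mul_add, Matrix.add_mul, Matrix.one_mul, Matrix.mul_one, smul_mul_assoc,
      mul_smul_comm, hNN, smul_add, smul_smul]
    rw [add_assoc, ← add_smul, ← add_smul]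
    have : b + (b + b * (b * -(2 + 2 * t))) = 0 := by
      rw [hb]; field_simp; ring
    rw [this, zero_smul, add_zero]
  refine ⟨1 + b • N, ?_, hSS, ?_⟩
  · have : (1 + b • N)ᴴ * Jform n = Jform n * (1 + b • N) := by
      simp [Matrix.add_mul, Matrix.mul_add, hNJ, hbstar, -Complex.star_def]
    rw [InUn1, this, Matrix.mul_assoc, hSS, Matrix.mul_one]
  · rw [add_mulVec, one_mulVec, smul_mulVec, hNx, huv, smul_smul,
      show b * -(1 + t) = -1 by rw [hb]; field_simp]
    simp [hu]

/-- The vector with last coordinate `s` and first coordinate `x`. -/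
noncomputable def planeVec (k : ℕ) (x s : ℂ) : Fin (k + 2) → ℂ :=
  Fin.snoc (α := fun _ => ℂ) (Pi.single 0 x : Fin (k + 1) → ℂ) s

theorem herm_planeVec (k : ℕ) (x s y u : ℂ) :
    herm (planeVec k x s) (planeVec k y u) = star x * y - star s * u := by
  rw [herm_eq]
  simp only [planeVec, Fin.snoc_castSucc, Fin.snoc_last]
  rw [Finset.sum_eq_single 0 (fun i _ hi => by simp [hi]) (by simp)]
  simp

/-- A vertex of a hyperbolic triangle can be rotated by three point reflections through any
angle of the open right half-circle. -/
theorem exists_three_involutions_mulVec_eq (k : ℕ) {ν : ℂ} (hν : star ν * ν = 1)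
    (hre : 0 < ν.re) :
    ∃ S₁ S₂ S₃, InUn1 (k + 1) S₁ ∧ S₁ * S₁ = 1 ∧ InUn1 (k + 1) S₂ ∧ S₂ * S₂ = 1 ∧
      InUn1 (k + 1) S₃ ∧ S₃ * S₃ = 1 ∧
      S₃ *ᵥ (S₂ *ᵥ (S₁ *ᵥ planeVec k 0 1)) = (-ν) • planeVec k 0 1 := by
  set a := ν.re with ha
  have hνn : a ^ 2 + ν.im ^ 2 = 1 := by
    have h := hν
    rw [Complex.star_def, ← Complex.normSq_eq_conj_mul_self, Complex.normSq_apply] at h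
    have : ν.re * ν.re + ν.im * ν.im = 1 := by exact_mod_cast h
    rw [ha]; linarith
  have ha1 : a ^ 2 ≤ 1 := by nlinarith [sq_nonneg ν.im]
  set R : ℝ := (4 / a ^ 2 - 3) / 2 with hR
  have hRpos : 0 < R := by
    have : 4 ≤ 4 / a ^ 2 := by rw [le_div_iff₀ (by positivity)]; linarith
    rw [hR]; linarith
  set r : ℝ := √R with hr
  have hr2 : r ^ 2 = R := Real.sq_sqrt hRpos.le
  have hrpos : 0 < r := Real.sqrt_pos.2 hRpos
  set s : ℝ := √(1 + R) with hs
  have hs2 : s ^ 2 = 1 + R := Real.sq_sqrt (by linarith)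
  have hspos : 0 ≤ s := Real.sqrt_nonneg _
  set y : ℂ := (1 + R - 2 / a * star ν) / r with hy
  have hyy : star y * y = R := by
    have h1 : star y * y = ((Complex.normSq y : ℝ) : ℂ) := by
      rw [Complex.normSq_eq_conj_mul_self]; rfl
    have h2 : Complex.normSq (1 + R - 2 / a * star ν : ℂ) = R ^ 2 := by
      have hre' : (1 + R - 2 / a * star ν : ℂ).re = 1 + R - 2 := by
        have : (2 / a * star ν : ℂ) = ((2 / a : ℝ) : ℂ) * star ν := by push_cast; rfl
        rw [Complex.sub_re, this, Complex.re_ofReal_mul]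
        simp [← ha]; field_simp
      have him' : (1 + R - 2 / a * star ν : ℂ).im = 2 / a * ν.im := by
        have : (2 / a * star ν : ℂ) = ((2 / a : ℝ) : ℂ) * star ν := by push_cast; rfl
        rw [Complex.sub_im, this, Complex.im_ofReal_mul]
        simp
      rw [Complex.normSq_apply, hre', him']
      have : ν.im ^ 2 = 1 - a ^ 2 := by linarith
      have e : 2 / a * ν.im * (2 / a * ν.im) = 4 / a ^ 2 - 4 := by
        calc 2 / a * ν.im * (2 / a * ν.im) = 4 / a ^ 2 * ν.im ^ 2 := by ring
          _ = _ := by rw [this]; field_simp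
      have e' : 4 / a ^ 2 = 2 * R + 3 := by rw [hR]; ring
      rw [e, e']; ring
    rw [h1, hy, map_div₀, h2, Complex.normSq_ofReal, ← sq, hr2]
    congr 1
    field_simp
  have hry : r * y = 1 + R - 2 / a * star ν := by
    rw [hy, mul_div_cancel₀ _ (by exact_mod_cast hrpos.ne')]
  have hr2' : (r : ℂ) * r = R := by rw [← sq]; exact_mod_cast hr2
  have hs2' : (s : ℂ) * s = 1 + R := by rw [← sq]; exact_mod_cast hs2
  have hstar : ∀ z : ℝ, star (z : ℂ) = z := fun z => Complex.conj_ofReal z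
  have he : herm (planeVec k 0 1) (planeVec k 0 1) = -1 := by simp [herm_planeVec]
  have hg : herm (-planeVec k r s) (-planeVec k r s) = -1 := by
    rw [herm_neg_left, herm_neg_right, herm_planeVec, hstar, hstar, hr2', hs2']; ring
  have hh : herm (ν • planeVec k y s) (ν • planeVec k y s) = -1 := by
    rw [herm_smul_left, herm_smul_right, herm_planeVec, hstar, hyy, hs2']
    linear_combination -hν
  have he' : herm ((-ν) • planeVec k 0 1) ((-ν) • planeVec k 0 1) = -1 := by
    rw [herm_smul_left, herm_smul_right, he, star_neg]
    linear_combination -hν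
  obtain ⟨S₁, h₁, h₁', e₁⟩ := exists_involution_mulVec_eq hspos he hg (by
    rw [herm_neg_right, herm_planeVec]; simp)
  obtain ⟨S₂, h₂, h₂', e₂⟩ := exists_involution_mulVec_eq (t := 2 / a) (by positivity) hg hh (by
    rw [herm_neg_left, herm_smul_right, herm_planeVec, hstar, hstar, hs2', hry]
    push_cast
    linear_combination (2 / a : ℂ) * hν)
  obtain ⟨S₃, h₃, h₃', e₃⟩ := exists_involution_mulVec_eq hspos hh he' (by
    rw [herm_smul_left, herm_smul_right, herm_planeVec, hstar]
    simp only [mul_zero, mul_one, zero_sub]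
    linear_combination (s : ℂ) * hν)
  exact ⟨S₁, S₂, S₃, h₁, h₁', h₂, h₂', h₃, h₃', by rw [e₁, e₂, e₃]⟩

/-- The block matrix `diag(U, 1)`. -/
noncomputable def blockOne (U : Matrix (Fin n) (Fin n) ℂ) : Matrix (Fin (n + 1)) (Fin (n + 1)) ℂ :=
  reindexAlgEquiv ℂ ℂ finSumFinEquiv (fromBlocks U 0 0 (1 : Matrix (Fin 1) (Fin 1) ℂ))

theorem blockOne_mul (U V : Matrix (Fin n) (Fin n) ℂ) :
    blockOne (U * V) = blockOne U * blockOne V := by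
  rw [blockOne, blockOne, blockOne, ← map_mul, fromBlocks_multiply]
  simp

theorem blockOne_one : blockOne (1 : Matrix (Fin n) (Fin n) ℂ) = 1 := by
  rw [blockOne, fromBlocks_one, map_one]

theorem blockOne_injective : Function.Injective (blockOne (n := n)) := by
  intro U V h
  exact (fromBlocks_inj.1 ((reindexAlgEquiv ℂ ℂ finSumFinEquiv).injective h)).1

theorem blockOne_conjTranspose (U : Matrix (Fin n) (Fin n) ℂ) :
    (blockOne U)ᴴ = blockOne Uᴴ := by
  simp [blockOne, conjTranspose_submatrix, fromBlocks_conjTranspose]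

theorem det_blockOne (U : Matrix (Fin n) (Fin n) ℂ) : (blockOne U).det = U.det := by
  simp [blockOne]

theorem Jform_eq_blocks : Jform n =
    reindexAlgEquiv ℂ ℂ finSumFinEquiv (fromBlocks 1 0 0 (-1 : Matrix (Fin 1) (Fin 1) ℂ)) := by
  ext i j
  refine Fin.lastCases ?_ (fun i => ?_) i <;> refine Fin.lastCases ?_ (fun j => ?_) j
  all_goals simp [Jform, diagonal_apply, one_apply]
  exact (Fin.castSucc_ne_last j).symm

theorem Jform_mul_blockOne (U : Matrix (Fin n) (Fin n) ℂ) :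
    Jform n * blockOne U = blockOne U * Jform n := by
  rw [Jform_eq_blocks, blockOne, ← map_mul, ← map_mul, fromBlocks_multiply, fromBlocks_multiply]
  simp

theorem inUn1_blockOne_iff (U : Matrix (Fin n) (Fin n) ℂ) :
    InUn1 n (blockOne U) ↔ Uᴴ * U = 1 := by
  rw [InUn1, Matrix.mul_assoc, Jform_mul_blockOne, ← Matrix.mul_assoc, blockOne_conjTranspose,
    ← blockOne_mul]
  constructor
  · intro h
    apply blockOne_injective
    calc blockOne (Uᴴ * U) = blockOne (Uᴴ * U) * Jform n * Jform n := by
          rw [Matrix.mul_assoc, Jform_mul_Jform, Matrix.mul_one]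
      _ = _ := by rw [h, Jform_mul_Jform, blockOne_one]
  · intro h
    rw [h, blockOne_one, Matrix.one_mul]

theorem IsUnitaryInvolution.blockOne {U : Matrix (Fin n) (Fin n) ℂ}
    (hU : IsUnitaryInvolution U) :
    InUn1 n (_root_.blockOne U) ∧ _root_.blockOne U * _root_.blockOne U = 1 :=
  ⟨(inUn1_blockOne_iff U).2 hU.1, by rw [← blockOne_mul, hU.2, blockOne_one]⟩

theorem InUn1.eq_blockOne {A : Matrix (Fin (n + 1)) (Fin (n + 1)) ℂ} (hA : InUn1 n A)
    (he : A *ᵥ Pi.single (Fin.last n) 1 = Pi.single (Fin.last n) 1) :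
    ∃ U, A = blockOne U := by
  have hcol : ∀ i, A i (Fin.last n) = if i = Fin.last n then 1 else 0 := by
    intro i
    have := congrFun he i
    simpa [Pi.single_apply] using this
  have hrow : ∀ j, A (Fin.last n) j = if j = Fin.last n then 1 else 0 := by
    intro j
    have := hA.herm_mulVec (Pi.single (Fin.last n) 1) (Pi.single j 1)
    rw [he] at this
    simpa [herm_eq, Pi.single_apply, Fin.castSucc_ne_last, eq_comm] using this
  refine ⟨A.submatrix Fin.castSucc Fin.castSucc, ?_⟩
  ext i j
  refine Fin.lastCases ?_ (fun i => ?_) i <;> refine Fin.lastCases ?_ (fun j => ?_) j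
  all_goals simp [blockOne, hcol, hrow]

end Hyperbolic

theorem exists_pow_eq_re_pos {N : ℕ} (hN : 3 ≤ N) {w : ℂ} (hw : star w * w = 1) :
    ∃ ν : ℂ, ν ^ N = w ∧ star ν * ν = 1 ∧ 0 < ν.re := by
  have hnorm : ∀ z : ℂ, star z * z = 1 ↔ ‖z‖ = 1 := by
    intro z
    rw [Complex.star_def, Complex.conj_mul']
    norm_cast
    exact pow_eq_one_iff_of_nonneg (norm_nonneg z) two_ne_zero
  have hN0 : (N : ℝ) ≠ 0 := by positivity
  refine ⟨Complex.exp ((w.arg / N : ℝ) * Complex.I), ?_, ?_, ?_⟩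
  · rw [← Complex.exp_nat_mul]
    have := Complex.norm_mul_exp_arg_mul_I w
    rw [(hnorm w).1 hw, Complex.ofReal_one, one_mul] at this
    conv_rhs => rw [← this]
    congr 1
    push_cast
    have : (N : ℂ) ≠ 0 := by exact_mod_cast hN0
    field_simp
  · rw [hnorm, Complex.norm_exp_ofReal_mul_I]
  · rw [Complex.exp_ofReal_mul_I_re]
    have h3 : (3 : ℝ) ≤ N := by exact_mod_cast hN
    have h : |w.arg / N| < Real.pi / 2 := by
      rw [abs_div, Nat.abs_cast, div_lt_iff₀ (by positivity)]
      nlinarith [Complex.abs_arg_le_pi w, Real.pi_pos]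
    exact Real.cos_pos_of_mem_Ioo (abs_lt.1 h)

/-- For every n ≥ 2, the involution length of PU(n,1) is at most 8. -/
theorem involution_length_le_eight (n : ℕ) (hn : 2 ≤ n)
    (A : Matrix (Fin (n + 1)) (Fin (n + 1)) ℂ) (hA : InUn1 n A) :
    ∃ (I₁ I₂ I₃ I₄ I₅ I₆ I₇ I₈ : Matrix (Fin (n + 1)) (Fin (n + 1)) ℂ) (c : ℂ),
      c ≠ 0 ∧
      InUn1 n I₁ ∧ I₁ * I₁ = 1 ∧
      InUn1 n I₂ ∧ I₂ * I₂ = 1 ∧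
      InUn1 n I₃ ∧ I₃ * I₃ = 1 ∧
      InUn1 n I₄ ∧ I₄ * I₄ = 1 ∧
      InUn1 n I₅ ∧ I₅ * I₅ = 1 ∧
      InUn1 n I₆ ∧ I₆ * I₆ = 1 ∧
      InUn1 n I₇ ∧ I₇ * I₇ = 1 ∧
      InUn1 n I₈ ∧ I₈ * I₈ = 1 ∧
      A = c • (I₁ * I₂ * I₃ * I₄ * I₅ * I₆ * I₇ * I₈) := by

  obtain ⟨k, rfl⟩ : ∃ k, n = k + 1 := ⟨n - 1, by omega⟩
  set e := planeVec k 0 1 with he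
  have hee : herm e e = -1 := by simp [he, herm_planeVec]
  have hff : herm (A *ᵥ e) (A *ᵥ e) = -1 := by rw [hA.herm_mulVec, hee]
  obtain ⟨κ, hκ, hκe⟩ : ∃ κ : ℂ, star κ * κ = 1 ∧
      κ * herm (A *ᵥ e) e = (‖herm (A *ᵥ e) e‖ : ℝ) := by
    set z := herm (A *ᵥ e) e
    by_cases hz : z = 0
    · exact ⟨1, by simp, by simp [hz]⟩
    · have hz' : (‖z‖ : ℂ) ≠ 0 := by exact_mod_cast norm_ne_zero_iff.2 hz
      have hzz : star z * z = (‖z‖ : ℂ) ^ 2 := Complex.conj_mul' z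
      refine ⟨star z / ‖z‖, ?_, ?_⟩
      · have : star (star z / (‖z‖ : ℂ)) = z / ‖z‖ := by simp
        rw [this, div_mul_div_comm, mul_comm, hzz]
        field_simp
      · rw [div_mul_eq_mul_div, hzz]
        field_simp
  obtain ⟨S₁, h₁, h₁', e₁⟩ := exists_involution_mulVec_eq (norm_nonneg _) hff
    (w := κ • e) (by rw [herm_smul_left, herm_smul_right, hee]; linear_combination -hκ)
    (by rw [herm_smul_right, hκe])
  obtain ⟨ν, hν, hν1, hνre⟩ := exists_pow_eq_re_pos (N := k + 1 + 1) (by omega)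
    (w := A.det * star κ ^ (k + 1 + 1)) (by
      rw [star_mul', star_pow, star_star]
      calc _ = (star A.det * A.det) * (star κ * κ) ^ (k + 1 + 1) := by ring
        _ = 1 := by rw [hκ, hA.star_det_mul_det, one_pow, one_mul])
  obtain ⟨S₂, S₃, S₄, h₂, h₂', h₃, h₃', h₄, h₄', e₂⟩ :=
    exists_three_involutions_mulVec_eq k hν1 hνre
  rw [← he] at e₂
  set c := κ * -ν with hc
  have hc1 : star c * c = 1 := by
    rw [hc, star_mul', star_neg]
    linear_combination (star κ * κ) * hν1 + hκ
  have hc0 : c ≠ 0 := right_ne_zero_of_mul_eq_one hc1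
  set E := star c • (S₄ * (S₃ * (S₂ * (S₁ * A)))) with hE
  have hEU : InUn1 (k + 1) E := (h₄.mul (h₃.mul (h₂.mul (h₁.mul hA)))).smul (by
    rw [star_star, mul_comm, hc1])
  have hEe : E *ᵥ e = e := by
    rw [hE, smul_mulVec, ← mulVec_mulVec, ← mulVec_mulVec, ← mulVec_mulVec, ← mulVec_mulVec, e₁,
      mulVec_smul, mulVec_smul, mulVec_smul, e₂, smul_smul, smul_smul, mul_assoc, ← hc, hc1,
      one_smul]
  have hsingle : e = Pi.single (Fin.last (k + 1)) 1 := by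
    ext i
    refine Fin.lastCases ?_ (fun i => ?_) i
    · simp [he, planeVec]
    · simp [he, planeVec, Fin.castSucc_ne_last]
  obtain ⟨U, hU⟩ := hEU.eq_blockOne (by rw [← hsingle, hEe])
  have hUdet : U.det ^ 2 = 1 := by
    have hS : ∀ {S : Matrix (Fin (k + 1 + 1)) (Fin (k + 1 + 1)) ℂ}, S * S = 1 → S.det ^ 2 = 1 := by
      intro S hS
      rw [sq, ← det_mul, hS, det_one]
    have hκd : (star c ^ (k + 1 + 1) * A.det) ^ 2 = 1 := by
      have h1 : c ^ (k + 1 + 1) = (-1) ^ (k + 1 + 1) * A.det := by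
        have : c ^ (k + 1 + 1) = (-1) ^ (k + 1 + 1) * (κ ^ (k + 1 + 1) * ν ^ (k + 1 + 1)) := by
          rw [hc, ← mul_pow, ← mul_pow]; ring
        rw [this, hν]
        calc _ = (-1) ^ (k + 1 + 1) * A.det * (star κ * κ) ^ (k + 1 + 1) := by ring
          _ = _ := by rw [hκ]; ring
      have h2 : ((-1 : ℂ) ^ (k + 1 + 1)) * (-1) ^ (k + 1 + 1) = 1 := by
        rw [← mul_pow]; simp
      have h3 : A.det = (-1) ^ (k + 1 + 1) * c ^ (k + 1 + 1) := by
        rw [h1, ← mul_assoc, h2, one_mul]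
      rw [h3]
      calc _ = ((-1) ^ (k + 1 + 1) * (-1) ^ (k + 1 + 1)) * ((star c * c) ^ (k + 1 + 1)) ^ 2 := by
            ring
        _ = 1 := by rw [h2, hc1]; simp
    rw [← det_blockOne, ← hU, hE, det_smul, det_mul, det_mul, det_mul, det_mul, Fintype.card_fin]
    calc _ = S₄.det ^ 2 * S₃.det ^ 2 * S₂.det ^ 2 * S₁.det ^ 2 *
          (star c ^ (k + 1 + 1) * A.det) ^ 2 := by ring
      _ = 1 := by rw [hS h₁', hS h₂', hS h₃', hS h₄', hκd]; norm_num
  have hUU : Uᴴ * U = 1 := (inUn1_blockOne_iff U).1 (hU ▸ hEU)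
  obtain ⟨M₁, M₂, M₃, M₄, m₁, m₂, m₃, m₄, hM⟩ := unitary_eq_four_involutions U hUU hUdet
  refine ⟨S₁, S₂, S₃, S₄, _, _, _, _, c, hc0, h₁, h₁', h₂, h₂', h₃, h₃', h₄, h₄',
    m₁.blockOne.1, m₁.blockOne.2, m₂.blockOne.1, m₂.blockOne.2, m₃.blockOne.1, m₃.blockOne.2,
    m₄.blockOne.1, m₄.blockOne.2, ?_⟩
  have hAE : S₁ * (S₂ * (S₃ * (S₄ * (c • E)))) = A := by
    have cancel : ∀ {S : Matrix (Fin (k + 1 + 1)) (Fin (k + 1 + 1)) ℂ}, S * S = 1 →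
        ∀ X, S * (S * X) = X := by
      intro S hS X
      rw [← Matrix.mul_assoc, hS, Matrix.one_mul]
    rw [hE, smul_smul, mul_comm c, hc1, one_smul, cancel h₄', cancel h₃', cancel h₂', cancel h₁']
  rw [← hAE, hU, hM, blockOne_mul, blockOne_mul, blockOne_mul]
  simp only [mul_smul_comm, Matrix.mul_assoc]
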